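/- arXiv:math/0403229 — 6 statements merged into one kernel-verified Lean document; each statement's English description precedes it below -/
import Mathlib

section
/- Let G be a finitely generated group, U a normal subgroup of G, and V = ⋂_{α ∈ Aut(G)} α(U). Then V is a characteristic subgroup of G contained in U, and: (a) if G/U is finite, then G/V is finite; (b) if p is a prime and G/U is a finite p-group, then G/V is a finite p-group; (c) if G/U is solvable-by-finite (i.e. has a solvable subgroup of finite index), then G/V is solvable-by-finite. -/
/-- The intersection `⋂_{α ∈ Aut G} α(U)` of all automorphic images of a normal subgroup
is a normal subgroup. -/
theorem normal_iInf_aut_map {G : Type*} [Group G] (U : Subgroup G) [hU : U.Normal] :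
    (⨅ α : G ≃* G, U.map (α : G →* G)).Normal := by
  constructor
  intro x hx g
  rw [Subgroup.mem_iInf] at hx ⊢
  intro α
  obtain ⟨u, hu, rfl⟩ := Subgroup.mem_map.mp (hx α)
  refine Subgroup.mem_map.mpr ⟨α.symm g * u * (α.symm g)⁻¹, hU.conj_mem u hu _, ?_⟩
  simp [map_mul]

/-- There are only finitely many homomorphisms from a finitely generated group to a finite group. -/
theorem finite_monoidHom_of_fg (G F : Type*) [Group G] [Group.FG G] [Group F] [Finite F] :
    Finite (G →* F) := by
  obtain ⟨S, hS⟩ := (Group.fg_def (G := G)).mp inferInstance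
  refine Finite.of_injective (fun (f : G →* F) (s : S) => f s) fun f g hfg => ?_
  exact MonoidHom.eq_of_eqOn_dense hS fun s hs => congrFun hfg ⟨s, hs⟩

/-- In a finitely generated group, the automorphic images of a subgroup of finite index
intersect in a subgroup of finite index. -/
theorem finiteIndex_iInf_aut_map {G : Type*} [Group G] [Group.FG G] (K : Subgroup G)
    [K.FiniteIndex] : (⨅ α : G ≃* G, K.map (α : G →* G)).FiniteIndex := by
  have := finite_monoidHom_of_fg G (G ⧸ K.normalCore)
  have : (⨅ f : G →* G ⧸ K.normalCore, f.ker).FiniteIndex :=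
    Subgroup.finiteIndex_iInf fun f => inferInstance
  refine Subgroup.finiteIndex_of_le (H := ⨅ f : G →* G ⧸ K.normalCore, f.ker)
    (le_iInf fun α => ?_)
  refine (iInf_le _ ((QuotientGroup.mk' K.normalCore).comp (α.symm : G →* G))).trans fun x hx => ?_
  rw [MonoidHom.mem_ker] at hx
  exact Subgroup.mem_map.mpr
    ⟨α.symm x, K.normalCore_le ((QuotientGroup.eq_one_iff _).mp hx), by simp⟩

/-- The intersection of all automorphic images of a subgroup is characteristic. -/
theorem characteristic_iInf_aut_map {G : Type*} [Group G] (U : Subgroup G) :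
    (⨅ α : G ≃* G, U.map (α : G →* G)).Characteristic := by
  refine Subgroup.characteristic_iff_le_comap.mpr fun φ x hx => ?_
  rw [Subgroup.mem_comap, Subgroup.mem_iInf]
  intro α
  obtain ⟨u, hu, hux⟩ := Subgroup.mem_map.mp (Subgroup.mem_iInf.mp hx (α.trans φ.symm))
  exact Subgroup.mem_map.mpr ⟨u, hu, by simp [← hux]⟩

/-- If `S ≤ G / U` is solvable with preimage `K` in `G`, then the image of `⋂ α(K)` in
`G / ⋂ α(U)` is solvable. -/
theorem isSolvable_map_iInf_aut_map {G : Type*} [Group G] (U V : Subgroup G) [U.Normal]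
    [V.Normal] (hV : V = ⨅ α : G ≃* G, U.map (α : G →* G)) (S : Subgroup (G ⧸ U))
    [hS : Group.IsSolvable S] :
    Group.IsSolvable ((⨅ α : G ≃* G, (S.comap (QuotientGroup.mk' U)).map (α : G →* G)).map
      (QuotientGroup.mk' V)) := by
  set W : Subgroup G := ⨅ α : G ≃* G, (S.comap (QuotientGroup.mk' U)).map (α : G →* G)
  have hmem (α : G ≃* G) (w : W) : QuotientGroup.mk' U (α.symm w) ∈ S := by
    obtain ⟨k, hk, hkw⟩ := Subgroup.mem_map.mp (Subgroup.mem_iInf.mp w.2 α)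
    simpa [← hkw] using hk
  obtain ⟨n, hn⟩ := hS.solvable
  refine ⟨n, eq_bot_iff.mpr ?_⟩
  rw [← map_derivedSeries_eq ((QuotientGroup.mk' V).subgroupMap_surjective W)]
  rintro _ ⟨w, hw, rfl⟩
  rw [Subgroup.mem_bot, Subtype.ext_iff]
  refine (QuotientGroup.eq_one_iff (w : G)).mpr ?_
  rw [hV, Subgroup.mem_iInf]
  intro α
  let φ : W →* S := (((QuotientGroup.mk' U).comp (α.symm : G →* G)).comp W.subtype).codRestrict S
    (hmem α)
  have hφ : φ w = 1 := by
    rw [← Subgroup.mem_bot, ← hn]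
    exact map_derivedSeries_le_derivedSeries φ n (Subgroup.mem_map_of_mem φ hw)
  exact Subgroup.mem_map.mpr
    ⟨α.symm w, (QuotientGroup.eq_one_iff _).mp (congrArg Subtype.val hφ), by simp⟩

/-- Let `G` be a finitely generated group, `U` a normal subgroup of `G`, and
`V = ⋂_{α ∈ Aut(G)} α(U)`. Then `V` is a characteristic subgroup of `G` contained in `U`, and:
(a) if `G/U` is finite, then `G/V` is finite;
(b) if `p` is a prime and `G/U` is a finite `p`-group, then `G/V` is a finite `p`-group;
(c) if `G/U` is solvable-by-finite (has a solvable subgroup of finite index), then so is `G/V`. -/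
theorem aut_intersection_of_finite_quotient {G : Type*} [Group G] [Group.FG G]
    (U : Subgroup G) [hU : U.Normal] :
    let V : Subgroup G := ⨅ α : G ≃* G, U.map (α : G →* G)
    letI : V.Normal := normal_iInf_aut_map U
    V.Characteristic ∧ V ≤ U ∧
      (Finite (G ⧸ U) → Finite (G ⧸ V)) ∧
      (∀ p : ℕ, p.Prime → Finite (G ⧸ U) → IsPGroup p (G ⧸ U) →
        Finite (G ⧸ V) ∧ IsPGroup p (G ⧸ V)) ∧
      ((∃ S : Subgroup (G ⧸ U), IsSolvable S ∧ S.FiniteIndex) →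
        ∃ T : Subgroup (G ⧸ V), IsSolvable T ∧ T.FiniteIndex) := by
  intro V
  have : V.Normal := normal_iInf_aut_map U
  have hfin : Finite (G ⧸ U) → Finite (G ⧸ V) := fun h => by
    have := Subgroup.finiteIndex_of_finite_quotient (H := U)
    have : V.FiniteIndex := finiteIndex_iInf_aut_map U
    exact Subgroup.finite_quotient_of_finiteIndex
  refine ⟨characteristic_iInf_aut_map U, ?_, hfin, fun p hp hU hpU => ⟨hfin hU, ?_⟩, ?_⟩
  · exact (iInf_le _ (MulEquiv.refl G)).trans_eq (Subgroup.map_id U)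
  · have := Fact.mk hp
    obtain ⟨n, hn⟩ := IsPGroup.iff_card.mp hpU
    intro x
    obtain ⟨g, rfl⟩ := QuotientGroup.mk_surjective x
    refine ⟨n, (QuotientGroup.eq_one_iff (g ^ p ^ n)).mpr (Subgroup.mem_iInf.mpr fun α => ?_)⟩
    refine Subgroup.mem_map.mpr ⟨α.symm g ^ p ^ n, ?_, by simp⟩
    rw [← QuotientGroup.eq_one_iff, QuotientGroup.mk_pow, ← hn, pow_card_eq_one']
  · rintro ⟨S, hS, hSfin⟩
    have : Group.IsSolvable S := hS
    have : (S.comap (QuotientGroup.mk' U)).FiniteIndex :=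
      ⟨(S.index_comap_of_surjective (QuotientGroup.mk'_surjective U)).trans_ne hSfin.index_ne_zero⟩
    have hW := finiteIndex_iInf_aut_map (S.comap (QuotientGroup.mk' U))
    exact ⟨_, isSolvable_map_iInf_aut_map U V rfl S,
      ⟨ne_zero_of_dvd_ne_zero hW.index_ne_zero
        (Subgroup.index_map_dvd _ (QuotientGroup.mk'_surjective V))⟩⟩
end

section
/- Let p be a prime, G a group, and H a normal subgroup of G such that G/H is a finite p-group. Then for every normal subgroup V of H such that H/V is a finite p-group, there exists a normal subgroup W of G such that G/W is a finite p-group and W ∩ H ≤ V. -/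
/-- If every element of a normal subgroup `H` has its `n`-th power in a subgroup `K`, then these
powers lie in the normal core of `K`. -/
theorem Subgroup.pow_mem_normalCore_of_forall_pow_mem {G : Type*} [Group G] {H K : Subgroup G}
    [H.Normal] {n : ℕ} (hK : ∀ h ∈ H, h ^ n ∈ K) {h : G} (hh : h ∈ H) :
    h ^ n ∈ K.normalCore := fun g => by
  rw [← conj_pow]
  exact hK _ (Subgroup.Normal.conj_mem inferInstance h hh g)


/-- Let `p` be a prime, `G` a group, and `H` a normal subgroup of `G` such
that `G/H` is a finite `p`-group. Then for every normal subgroup `V` of `H` such that `H/V`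
is a finite `p`-group, there exists a normal subgroup `W` of `G` such that `G/W` is a finite
`p`-group and `W ∩ H ≤ V`. -/
theorem exists_normal_pPower_index_inter_le {p : ℕ} (hp : p.Prime) {G : Type*} [Group G]
    (H : Subgroup G) [H.Normal] (hGH_fin : Finite (G ⧸ H)) (hGH_p : IsPGroup p (G ⧸ H))
    (V : Subgroup H) [V.Normal] (hHV_fin : Finite (H ⧸ V)) (hHV_p : IsPGroup p (H ⧸ V)) :
    ∃ W : Subgroup G, ∃ hW : W.Normal,
      (haveI := hW; Finite (G ⧸ W) ∧ IsPGroup p (G ⧸ W)) ∧ W.subgroupOf H ≤ V := by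
  have : Fact p.Prime := ⟨hp⟩
  obtain ⟨n, hn⟩ := IsPGroup.iff_card.mp hHV_p
  have hpow : ∀ h ∈ H, h ^ p ^ n ∈ V.map H.subtype := fun h hh =>
    ⟨⟨h, hh⟩ ^ p ^ n, by
      rw [← hn]
      exact Subgroup.pow_index_mem V _, rfl⟩
  have : H.FiniteIndex := Subgroup.finiteIndex_of_finite_quotient
  have : V.FiniteIndex := Subgroup.finiteIndex_of_finite_quotient
  have : (V.map H.subtype).FiniteIndex := ⟨by
    rw [Subgroup.index_map_subtype]
    exact mul_ne_zero Subgroup.FiniteIndex.index_ne_zero Subgroup.FiniteIndex.index_ne_zero⟩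
  refine ⟨(V.map H.subtype).normalCore, inferInstance, ⟨inferInstance, ?_⟩, ?_⟩
  · rw [isPGroup_iff_pow_pow_eq_one] at hGH_p ⊢
    rintro ⟨g⟩
    obtain ⟨k, hk⟩ := hGH_p g
    have hg : g ^ p ^ k ∈ H := (QuotientGroup.eq_one_iff _).mp hk
    refine ⟨k + n, (QuotientGroup.eq_one_iff (g ^ p ^ (k + n))).mpr ?_⟩
    rw [pow_add, pow_mul]
    exact Subgroup.pow_mem_normalCore_of_forall_pow_mem hpow hg
  · intro h hh
    obtain ⟨v, hv, hvh⟩ := Subgroup.normalCore_le _ (Subgroup.mem_subgroupOf.mp hh)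
    exact Subtype.ext hvh ▸ hv
end

section
/- Let p be a prime and H a finite p-group with γ^p_{k+1}(H) = {1} for some k ≥ 1 (i.e. of nilpotent p-length at most k). Let α be an automorphism of H such that the induced action on H/γ^p_2(H) is trivial, i.e. x⁻¹·α(x) ∈ γ^p_2(H) for every x ∈ H. Then α^{p^{k−1}} = id_H. -/
/-- The `p`-lower central series of a group `H`: `pLowerCentralSeries p H k = γ^p_{k+1}(H)`,
where `γ^p_1(H) = H` and `γ^p_{k+1}(H)` is the subgroup generated by `⁅γ^p_k(H), H⁆`
together with all `p`-th powers of elements of `γ^p_k(H)`. -/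
def pLowerCentralSeries (p : ℕ) (H : Type*) [Group H] : ℕ → Subgroup H
  | 0 => ⊤
  | (k + 1) => ⁅pLowerCentralSeries p H k, (⊤ : Subgroup H)⁆ ⊔
      Subgroup.closure ((fun x => x ^ p) '' (pLowerCentralSeries p H k : Set H))

namespace pLowerCentralSeries

open scoped commutatorElement

variable {p : ℕ} {H : Type*} [Group H]

instance normal (k : ℕ) : (pLowerCentralSeries p H k).Normal := by
  induction k with
  | zero => exact Subgroup.normal_of_characteristic (⊤ : Subgroup H)
  | succ k ih =>
    have : (Subgroup.closure
        ((fun x => x ^ p) '' (pLowerCentralSeries p H k : Set H))).Normal := by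
      refine ⟨fun n hn g => ?_⟩
      induction hn using Subgroup.closure_induction with
      | mem x hx =>
        obtain ⟨y, hy, rfl⟩ := hx
        exact Subgroup.subset_closure ⟨g * y * g⁻¹, ih.conj_mem y hy g, conj_pow⟩
      | one => simp
      | mul x y _ _ hx hy => simpa [mul_assoc] using mul_mem hx hy
      | inv x _ hx => simpa [mul_assoc] using inv_mem hx
    exact Subgroup.sup_normal _ _

theorem commutatorElement_mem_succ {k : ℕ} {x : H} (hx : x ∈ pLowerCentralSeries p H k) (y : H) :
    ⁅x, y⁆ ∈ pLowerCentralSeries p H (k + 1) :=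
  Subgroup.mem_sup_left (Subgroup.commutator_mem_commutator hx (Subgroup.mem_top y))

theorem pow_mem_succ {k : ℕ} {x : H} (hx : x ∈ pLowerCentralSeries p H k) :
    x ^ p ∈ pLowerCentralSeries p H (k + 1) :=
  Subgroup.mem_sup_right (Subgroup.subset_closure ⟨x, hx, rfl⟩)

theorem succ_le_iff {k : ℕ} {K : Subgroup H} :
    pLowerCentralSeries p H (k + 1) ≤ K ↔
      ∀ x ∈ pLowerCentralSeries p H k, x ^ p ∈ K ∧ ∀ y, ⁅x, y⁆ ∈ K := by
  refine ⟨fun h x hx => ⟨h (pow_mem_succ hx), fun y => h (commutatorElement_mem_succ hx y)⟩,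
    fun h => sup_le (Subgroup.commutator_le.2 fun x hx y _ => (h x hx).2 y) ?_⟩
  rw [Subgroup.closure_le]
  rintro _ ⟨x, hx, rfl⟩
  exact (h x hx).1

theorem succ_le (k : ℕ) : pLowerCentralSeries p H (k + 1) ≤ pLowerCentralSeries p H k :=
  succ_le_iff.2 fun _ hx => ⟨pow_mem hx p, fun y =>
    Subgroup.commutator_le_left _ _ (Subgroup.commutator_mem_commutator hx (Subgroup.mem_top y))⟩

theorem commute_mk {k : ℕ} {x : H} (hx : x ∈ pLowerCentralSeries p H k) (y : H) :
    Commute (x : H ⧸ pLowerCentralSeries p H (k + 1)) y := by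
  rw [commute_iff_eq, ← commutatorElement_eq_one_iff_mul_comm]
  exact (QuotientGroup.eq_one_iff _).2 (commutatorElement_mem_succ hx y)

theorem mk_pow_eq_one {k : ℕ} {x : H} (hx : x ∈ pLowerCentralSeries p H k) :
    (x : H ⧸ pLowerCentralSeries p H (k + 1)) ^ p = 1 :=
  (QuotientGroup.eq_one_iff _).2 (pow_mem_succ hx)

/-- For `x` in the `k`-th term, the homomorphism `y ↦ ⁅x, y⁆` modulo the `(k + 2)`-nd term. -/
def commutatorHom {k : ℕ} {x : H} (hx : x ∈ pLowerCentralSeries p H k) :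
    H →* H ⧸ pLowerCentralSeries p H (k + 2) where
  toFun y := (⁅x, y⁆ : H)
  map_one' := by simp
  map_mul' y z := by
    have h := commute_mk (commutatorElement_mem_succ hx z) y
    calc ((⁅x, y * z⁆ : H) : H ⧸ pLowerCentralSeries p H (k + 2))
        = (⁅x, y⁆ : H) * ((y : H ⧸ pLowerCentralSeries p H (k + 2)) * (⁅x, z⁆ : H)
            * (y : H ⧸ pLowerCentralSeries p H (k + 2))⁻¹) := by
          rw [← QuotientGroup.mk_inv, ← QuotientGroup.mk_mul, ← QuotientGroup.mk_mul,
            ← QuotientGroup.mk_mul]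
          congr 1
          simp only [commutatorElement_def]
          group
      _ = _ := by rw [← h.eq, mul_inv_cancel_right]

theorem le_ker_commutatorHom {k : ℕ} {x : H} (hx : x ∈ pLowerCentralSeries p H k) :
    pLowerCentralSeries p H 1 ≤ (commutatorHom hx).ker := by
  refine succ_le_iff.2 fun y _ => ⟨?_, fun z => ?_⟩
  · rw [MonoidHom.mem_ker, map_pow]
    exact mk_pow_eq_one (commutatorElement_mem_succ hx y)
  · rw [MonoidHom.mem_ker, map_commutatorElement, commutatorElement_eq_one_iff_mul_comm]
    exact commute_mk (commutatorElement_mem_succ hx y) _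

/-- An endomorphism acting trivially on the first factor of the `p`-lower central series acts
trivially on all its factors. -/
theorem mk_map_eq {α : H →* H} (hα : ∀ x : H, x⁻¹ * α x ∈ pLowerCentralSeries p H 1) (k : ℕ) :
    ∀ x ∈ pLowerCentralSeries p H k,
      (α x : H ⧸ pLowerCentralSeries p H (k + 1)) = x := by
  induction k with
  | zero => exact fun x _ => (QuotientGroup.eq.2 (hα x)).symm
  | succ k ih =>
    let π := QuotientGroup.mk' (pLowerCentralSeries p H (k + 2))
    suffices pLowerCentralSeries p H (k + 1) ≤ (π.comp α).eqLocus π from fun x hx => this hx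
    refine succ_le_iff.2 fun x hx => ?_
    obtain ⟨c, hc, hxc⟩ : ∃ c ∈ pLowerCentralSeries p H (k + 1), α x = x * c :=
      ⟨x⁻¹ * α x, QuotientGroup.eq.1 (ih x hx).symm, by simp⟩
    refine ⟨?_, fun y => ?_⟩
    · change π (α (x ^ p)) = π (x ^ p)
      have hcx : Commute (π c) (π x) := commute_mk hc x
      have hcp : π c ^ p = 1 := mk_pow_eq_one hc
      rw [map_pow, map_pow, map_pow, hxc, map_mul, hcx.symm.mul_pow, hcp, mul_one]
    · change π (α ⁅x, y⁆) = π ⁅x, y⁆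
      have hcy : Commute (π c) (π (α y)) := commute_mk hc (α y)
      calc π (α ⁅x, y⁆) = π ⁅x, α y⁆ := by
            simp only [map_commutatorElement, hxc, map_mul]
            rw [commutatorElement_def, mul_assoc (π x), hcy.eq, commutatorElement_def]
            group
        _ = commutatorHom hx (y * (y⁻¹ * α y)) := by
            rw [mul_inv_cancel_left]; rfl
        _ = π ⁅x, y⁆ := by
            rw [map_mul, MonoidHom.mem_ker.1 (le_ker_commutatorHom hx (hα y)), mul_one]; rfl

theorem mk_pow_apply_eq {α : MulAut H} (hα : ∀ x : H, x⁻¹ * α x ∈ pLowerCentralSeries p H 1)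
    (k n : ℕ) {x : H} (hx : x ∈ pLowerCentralSeries p H k) :
    ((α ^ n) x : H ⧸ pLowerCentralSeries p H (k + 1)) = x := by
  induction n generalizing x with
  | zero => rfl
  | succ n ih =>
    have h : (α x : H ⧸ pLowerCentralSeries p H (k + 1)) = x :=
      mk_map_eq (α := α.toMonoidHom) hα k x hx
    have hmem : α x ∈ pLowerCentralSeries p H k := by
      simpa using mul_mem hx (succ_le k (QuotientGroup.eq.1 h.symm))
    rw [pow_succ, MulAut.mul_apply, ih hmem, h]

theorem mk_pow_apply_eq_mul_pow {α : MulAut H}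
    (hα : ∀ x : H, x⁻¹ * α x ∈ pLowerCentralSeries p H 1)
    {k : ℕ} {x : H} (hx : x⁻¹ * α x ∈ pLowerCentralSeries p H k) (n : ℕ) :
    ((α ^ n) x : H ⧸ pLowerCentralSeries p H (k + 1)) = x * (x⁻¹ * α x : H) ^ n := by
  induction n with
  | zero => simp
  | succ n ih =>
    have h : (α ^ (n + 1)) x = (α ^ n) x * (α ^ n) (x⁻¹ * α x) := by
      rw [← map_mul, mul_inv_cancel_left, pow_succ, MulAut.mul_apply]
    rw [h, QuotientGroup.mk_mul, ih, mk_pow_apply_eq hα k n hx, pow_succ, mul_assoc]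

theorem inv_mul_pow_apply_mem {α : MulAut H}
    (hα : ∀ x : H, x⁻¹ * α x ∈ pLowerCentralSeries p H 1) (k : ℕ) :
    ∀ x : H, x⁻¹ * (α ^ p ^ k) x ∈ pLowerCentralSeries p H (k + 1) := by
  induction k with
  | zero => simpa using hα
  | succ k ih =>
    intro x
    have hβ : ∀ x : H, x⁻¹ * (α ^ p ^ k) x ∈ pLowerCentralSeries p H 1 := fun x =>
      QuotientGroup.eq.1 (mk_pow_apply_eq hα 0 (p ^ k) (Subgroup.mem_top x)).symm
    rw [pow_succ, pow_mul, ← QuotientGroup.eq, mk_pow_apply_eq_mul_pow hβ (ih x),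
      mk_pow_eq_one (ih x), mul_one]

end pLowerCentralSeries

/-- Let `p` be a prime and `H` a finite `p`-group with
`γ^p_{k+1}(H) = {1}` for some `k ≥ 1` (nilpotent `p`-length at most `k`). Let `α` be an
automorphism of `H` acting trivially on `H/γ^p_2(H)`, i.e. `x⁻¹·α(x) ∈ γ^p_2(H)` for every
`x ∈ H`. Then `α^{p^{k−1}} = id_H`. -/
theorem aut_pow_eq_one_of_trivial_on_pAbelianization {p : ℕ} (hp : p.Prime)
    {H : Type*} [Group H] [Finite H] (hHp : IsPGroup p H) (k : ℕ) (hk : 1 ≤ k)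
    (hlen : pLowerCentralSeries p H k = ⊥)
    (α : MulAut H) (hα : ∀ x : H, x⁻¹ * α x ∈ pLowerCentralSeries p H 1) :
    α ^ p ^ (k - 1) = 1 := by
  ext x
  have h := pLowerCentralSeries.inv_mul_pow_apply_mem hα (k - 1) x
  rw [Nat.sub_add_cancel hk, hlen, Subgroup.mem_bot, inv_mul_eq_one] at h
  exact h.symm
end

section
/- Let p be a prime, H a finite p-group, G a group, and ρ : G → Aut(H) a homomorphism. Since γ^p_2(H) is characteristic, each ρ(g) induces an automorphism ρ̄(g) of the ℤ/p-vector space H/γ^p_2(H). Suppose every element of G acts unipotently on H/γ^p_2(H), i.e. for each g ∈ G there is n with (ρ̄(g) − id)^n = 0. Then the image ρ(G) ≤ Aut(H) is a finite p-group. -/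
section

open Subgroup
open scoped commutatorElement

/-- In a finite `p`-group, maximal subgroups contain all commutators and `p`-th powers. -/
theorem IsPGroup.commutator_mem_and_pow_mem_of_isCoatom {p : ℕ} [Fact p.Prime] {H : Type*}
    [Group H] [Finite H] (hH : IsPGroup p H) {K : Subgroup H} (hK : IsCoatom K) :
    (∀ x y : H, ⁅x, y⁆ ∈ K) ∧ ∀ x : H, x ^ p ∈ K := by
  have := hH.isNilpotent
  have : K.Normal := Group.normalizerCondition_of_isNilpotent.normal_of_coatom K hK
  have generates (x : H) (hx : x ∉ K) (y : H) : ∃ n : ℤ, (x : H ⧸ K) ^ n = y := by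
    have htop : (zpowers (x : H ⧸ K)).comap (QuotientGroup.mk' K) = ⊤ := by
      refine hK.2 _ (lt_of_le_of_ne (fun k hk => ?_) ?_)
      · rw [mem_comap, QuotientGroup.mk'_apply, (QuotientGroup.eq_one_iff k).2 hk]
        exact one_mem _
      · rintro h
        exact hx (h ▸ mem_zpowers (x : H ⧸ K))
    have hy : y ∈ (zpowers (x : H ⧸ K)).comap (QuotientGroup.mk' K) := htop ▸ mem_top y
    exact mem_zpowers_iff.1 hy
  refine ⟨fun x y => ?_, fun x => ?_⟩
  · rw [← QuotientGroup.eq_one_iff]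
    change ⁅(x : H ⧸ K), (y : H ⧸ K)⁆ = 1
    rw [commutatorElement_eq_one_iff_commute]
    by_cases hx : x ∈ K
    · rw [(QuotientGroup.eq_one_iff x).2 hx]
      exact Commute.one_left _
    · obtain ⟨n, hn⟩ := generates x hx y
      rw [← hn]
      exact (Commute.refl _).zpow_right n
  · by_contra hx
    obtain ⟨n, hn⟩ := generates _ hx x
    have hone : (x : H ⧸ K) ^ (p * n - 1) = 1 := by
      rw [zpow_sub_one, zpow_mul, zpow_natCast, ← QuotientGroup.mk_pow, hn, mul_inv_cancel]
    obtain ⟨k, hk⟩ := IsPGroup.iff_orderOf.1 (hH.to_quotient K) (x : H ⧸ K)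
    have hdvd := orderOf_dvd_iff_zpow_eq_one.2 hone
    rw [hk] at hdvd
    have hk0 : k = 0 := by
      by_contra hk0
      have hp : (p : ℤ) ∣ p * n - 1 :=
        (Int.natCast_dvd_natCast.2 (dvd_pow_self p hk0)).trans hdvd
      have : (p : ℤ) ∣ 1 := (dvd_sub_right (dvd_mul_right _ n)).1 hp
      exact (Fact.out : p.Prime).one_lt.ne'
        (Nat.dvd_one.1 (Int.natCast_dvd_natCast.1 (by simpa using this)))
    rw [hk0, pow_zero, orderOf_eq_one_iff, QuotientGroup.eq_one_iff] at hk
    exact hx (pow_mem hk p)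

theorem IsPGroup.commutator_mem_frattini {p : ℕ} [Fact p.Prime] {H : Type*}
    [Group H] [Finite H] (hH : IsPGroup p H) (x y : H) : ⁅x, y⁆ ∈ frattini H := by
  simp only [frattini, Order.radical, mem_iInf]
  exact fun K hK => (hH.commutator_mem_and_pow_mem_of_isCoatom hK).1 x y

theorem IsPGroup.pow_mem_frattini {p : ℕ} [Fact p.Prime] {H : Type*}
    [Group H] [Finite H] (hH : IsPGroup p H) (x : H) : x ^ p ∈ frattini H := by
  simp only [frattini, Order.radical, mem_iInf]
  exact fun K hK => (hH.commutator_mem_and_pow_mem_of_isCoatom hK).2 x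

theorem IsPGroup.pLowerCentralSeries_one_le_frattini {p : ℕ} [Fact p.Prime] {H : Type*}
    [Group H] [Finite H] (hH : IsPGroup p H) : pLowerCentralSeries p H 1 ≤ frattini H := by
  refine sup_le (commutator_le.2 fun x _ y _ => hH.commutator_mem_frattini x y) ?_
  rw [closure_le]
  rintro _ ⟨x, -, rfl⟩
  exact hH.pow_mem_frattini x

/-- A unipotent endomorphism of an elementary abelian `p`-group has `p`-power order. -/
theorem AddMonoid.End.pow_prime_pow_eq_one {p : ℕ} (hp : p.Prime) {A : Type*} [AddCommGroup A]
    (hA : ∀ x : A, p • x = 0) (f : AddMonoid.End A) {n : ℕ} (hf : (f - 1) ^ n = 0) :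
    f ^ p ^ n = 1 := by
  have hp0 : (p : AddMonoid.End A) = 0 := by
    ext x
    simpa using hA x
  obtain ⟨r, hr⟩ := (Commute.one_right (f - 1)).exists_add_pow_prime_pow_eq hp n
  rw [sub_add_cancel, hp0, pow_eq_zero_of_le (Nat.lt_pow_self hp.one_lt).le hf] at hr
  simpa using hr

theorem map_mem_frattini {H : Type*} [Group H] (a : MulAut H) {x : H} (hx : x ∈ frattini H) :
    a x ∈ frattini H :=
  frattini_le_comap_frattini_of_surjective (φ := a.toMonoidHom) a.surjective hx

/-- If `a` acts unipotently on the Frattini quotient of a finite `p`-group, then some `p`-power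
of `a` acts trivially there. -/
theorem IsPGroup.inv_mul_pow_mem_frattini {p : ℕ} [Fact p.Prime] {H : Type*} [Group H]
    [Finite H] (hH : IsPGroup p H) (a : MulAut H) {n : ℕ}
    (ha : ∀ x : H, (fun y : H => y⁻¹ * a y)^[n] x ∈ frattini H) (x : H) :
    x⁻¹ * (a ^ p ^ n) x ∈ frattini H := by
  let Q := H ⧸ frattini H
  let _ : CommGroup Q :=
    { (inferInstance : Group Q) with
      mul_comm := by
        rintro ⟨x⟩ ⟨y⟩
        exact commutatorElement_eq_one_iff_mul_comm.1
          ((QuotientGroup.eq_one_iff ⁅x, y⁆).2 (hH.commutator_mem_frattini x y)) }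
  let π : H → Additive Q := fun x => Additive.ofMul (x : Q)
  have hπ (x y : H) : π (x⁻¹ * y) = π y - π x := by
    rw [sub_eq_neg_add]
    rfl
  let f : AddMonoid.End (Additive Q) :=
    (QuotientGroup.map (frattini H) (frattini H) a.toMonoidHom
      (fun _ hx => map_mem_frattini a hx)).toAdditive
  have hfπ (x : H) : f (π x) = π (a x) := rfl
  have hsurj (z : Additive Q) : ∃ x, π x = z := QuotientGroup.mk_surjective z
  have hπ0 (x : H) : π x = 0 ↔ x ∈ frattini H := QuotientGroup.eq_one_iff x
  have hiter (m : ℕ) (x : H) : ((f - 1) ^ m) (π x) = π ((fun y : H => y⁻¹ * a y)^[m] x) := by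
    induction m with
    | zero => rfl
    | succ m ih =>
      rw [pow_succ', Function.iterate_succ_apply', hπ, ← hfπ, ← ih]
      rfl
  have hpow (m : ℕ) (x : H) : (f ^ m) (π x) = π ((a ^ m) x) := by
    induction m with
    | zero => rfl
    | succ m ih =>
      rw [pow_succ', pow_succ', MulAut.mul_apply, ← hfπ, ← ih]
      rfl
  have hf : f ^ p ^ n = 1 := by
    refine AddMonoid.End.pow_prime_pow_eq_one Fact.out (fun z => ?_) f ?_
    · obtain ⟨x, rfl⟩ := hsurj z
      exact (hπ0 _).2 (hH.pow_mem_frattini x)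
    · ext z
      obtain ⟨x, rfl⟩ := hsurj z
      rw [hiter]
      exact (hπ0 _).2 (ha x)
  rw [← hπ0, hπ, ← hpow, hf]
  exact sub_self _

/-- An automorphism of a finite `p`-group that has order dividing a prime `q ≠ p` and acts
trivially on the Frattini quotient is trivial. -/
theorem IsPGroup.mulAut_eq_one_of_pow_prime_eq_one {p q : ℕ} [Fact p.Prime] [Fact q.Prime]
    (hpq : q ≠ p) {H : Type*} [Group H] [Finite H] (hH : IsPGroup p H) (c : MulAut H)
    (hc : ∀ x : H, x⁻¹ * c x ∈ frattini H) (hq : c ^ q = 1) : c = 1 := by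
  let F : Subgroup H := c.toMonoidHom.eqLocus (MonoidHom.id H)
  suffices hF : F = ⊤ by
    ext x
    exact (hF ▸ mem_top x : x ∈ F)
  refine frattini_nongenerating (eq_top_iff.2 fun x _ => ?_)
  let S := {u : H // u ∈ frattini H}
  have := Fintype.ofFinite S
  have hcard : ¬ q ∣ Fintype.card S := by
    obtain ⟨k, hk⟩ := IsPGroup.iff_card.1 (hH.to_subgroup (frattini H))
    rw [← Nat.card_eq_fintype_card, show Nat.card S = p ^ k from hk]
    exact fun h => hpq ((Nat.prime_dvd_prime_iff_eq Fact.out Fact.out).1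
      (Nat.Prime.dvd_of_dvd_pow Fact.out h))
  let e : Equiv.Perm H := (Equiv.mulLeft x).trans (c.toEquiv.trans (Equiv.mulLeft x⁻¹))
  have he (u : H) : e u = x⁻¹ * c x * c u := by
    simp [e, mul_assoc]
  have hmem (u : H) : e u ∈ frattini H ↔ u ∈ frattini H := by
    rw [he, mul_mem_cancel_left (hc x)]
    exact ⟨fun h => by simpa using map_mem_frattini c⁻¹ h, map_mem_frattini c⟩
  have hpow (k : ℕ) (u : H) : (e ^ k) u = x⁻¹ * (c ^ k) (x * u) := by
    induction k with
    | zero => simp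
    | succ k ih =>
      rw [pow_succ', pow_succ', Equiv.Perm.mul_apply, MulAut.mul_apply, ih, he]
      simp [mul_assoc]
  have hσ : (e.subtypePerm hmem : Equiv.Perm S) ^ q ^ 1 = 1 := by
    ext u
    rw [pow_one, Equiv.Perm.subtypePerm_pow]
    simp [hpow, hq]
  obtain ⟨⟨u, hu⟩, hfix⟩ := Equiv.Perm.exists_fixed_point_of_prime hcard hσ
  have hxu : x * u ∈ F := by
    have h : x⁻¹ * c (x * u) = u := by
      have heu : e u = u := congrArg Subtype.val hfix
      simpa [he, mul_assoc] using heu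
    exact inv_mul_eq_iff_eq_mul.1 h
  rw [← mul_inv_cancel_right x u]
  exact mul_mem_sup hxu (inv_mem hu)

theorem IsPGroup.exists_orderOf_eq_pow_of_inv_mul_mem_frattini {p : ℕ} [Fact p.Prime]
    {H : Type*} [Group H] [Finite H] (hH : IsPGroup p H) (b : MulAut H)
    (hb : ∀ x : H, x⁻¹ * b x ∈ frattini H) : ∃ k, orderOf b = p ^ k := by
  have hpos : orderOf b ≠ 0 := (orderOf_pos b).ne'
  refine ⟨_, Nat.eq_prime_pow_of_unique_prime_dvd hpos fun {q} hq hqb => ?_⟩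
  by_contra hqp
  have : Fact q.Prime := ⟨hq⟩
  have hbk (k : ℕ) (x : H) : x⁻¹ * (b ^ k) x ∈ frattini H := by
    induction k with
    | zero => simp
    | succ k ih =>
      have h := mul_mem ih (hb ((b ^ k) x))
      rwa [mul_assoc, mul_inv_cancel_left, ← MulAut.mul_apply, ← pow_succ'] at h
  have hord := orderOf_pow_orderOf_div hpos hqb
  have hone := hH.mulAut_eq_one_of_pow_prime_eq_one hqp (b ^ (orderOf b / q)) (hbk _)
    (by rw [← pow_mul, Nat.div_mul_cancel hqb, pow_orderOf_eq_one])
  rw [hone, orderOf_one] at hord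
  exact hq.one_lt.ne hord

end

/-- Let `p` be a prime, `H` a finite `p`-group, `G` a group, and
`ρ : G → Aut(H)` a homomorphism. Suppose every element `g` of `G` acts unipotently on the
`ℤ/p`-vector space `H/γ^p_2(H)`, i.e. for each `g` there is `n` with
`(ρ̄(g) − id)^n = 0`; multiplicatively, the `n`-th iterate of `y ↦ y⁻¹·(ρ g)(y)` lands in
`γ^p_2(H)`. Then the image `ρ(G) ≤ Aut(H)` is a finite `p`-group. -/
theorem range_isPGroup_of_unipotent_on_pAbelianization {p : ℕ} (hp : p.Prime)
    {H : Type*} [Group H] [Finite H] (hHp : IsPGroup p H)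
    {G : Type*} [Group G] (ρ : G →* MulAut H)
    (hunip : ∀ g : G, ∃ n : ℕ, ∀ x : H,
      (fun y : H => y⁻¹ * ρ g y)^[n] x ∈ pLowerCentralSeries p H 1) :
    Finite ρ.range ∧ IsPGroup p ρ.range := by
  have : Fact p.Prime := ⟨hp⟩
  refine ⟨inferInstance, ?_⟩
  rintro ⟨_, g, rfl⟩
  obtain ⟨n, hn⟩ := hunip g
  obtain ⟨k, hk⟩ := hHp.exists_orderOf_eq_pow_of_inv_mul_mem_frattini (ρ g ^ p ^ n)
    (hHp.inv_mul_pow_mem_frattini (ρ g) fun x => hHp.pLowerCentralSeries_one_le_frattini (hn x))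
  refine ⟨n + k, Subtype.ext ?_⟩
  change ρ g ^ p ^ (n + k) = 1
  rw [pow_add, pow_mul, ← hk, pow_orderOf_eq_one]
end

section
/- Let G be a group and {1} = G_0 ≤ G_1 ≤ ⋯ ≤ G_n = G a chain of subgroups, each normal in G. Suppose that for each 0 ≤ i < n there exists m with [G_{i+1}, G; m] ≤ G_i · ⁅G_{i+1}, G_{i+1}⁆ (the join of G_i and the commutator subgroup of G_{i+1}); this expresses that G/G_i acts unipotently on H_1(G_{i+1}/G_i; ℤ). Then for each 0 ≤ i ≤ n there exists m with [G_i, G; m] ≤ ⁅G_i, G_i⁆, i.e. G acts unipotently on H_1(G_i; ℤ). -/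
/-- The iterated commutator subgroup `[A, B; m]`, defined by `[A, B; 0] = A` and
`[A, B; m+1] = ⁅[A, B; m], B⁆`. -/
def iteratedCommutator {G : Type*} [Group G] (A B : Subgroup G) : ℕ → Subgroup G
  | 0 => A
  | (m + 1) => ⁅iteratedCommutator A B m, B⁆

theorem iteratedCommutator_add {G : Type*} [Group G] (A B : Subgroup G) (k m : ℕ) :
    iteratedCommutator A B (k + m) = iteratedCommutator (iteratedCommutator A B k) B m := by
  induction m with
  | zero => rfl
  | succ m ih => exact congrArg (⁅·, B⁆) ih

theorem iteratedCommutator_mono {G : Type*} [Group G] {A A' : Subgroup G} (B : Subgroup G)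
    (h : A ≤ A') (m : ℕ) : iteratedCommutator A B m ≤ iteratedCommutator A' B m := by
  induction m with
  | zero => exact h
  | succ m ih => exact Subgroup.commutator_mono ih le_rfl

open scoped commutatorElement in
theorem commutator_sup_le_sup {G : Type*} [Group G] (A N B : Subgroup G) [N.Normal] :
    ⁅A ⊔ N, B⁆ ≤ ⁅A, B⁆ ⊔ N := by
  rw [Subgroup.commutator_le]
  intro x hx b hb
  obtain ⟨a, ha, c, hc, rfl⟩ := Subgroup.mem_sup_of_normal_right.mp hx
  have hcb : ⁅c, b⁆ ∈ N :=
    Subgroup.commutator_le_left N B (Subgroup.commutator_mem_commutator hc hb)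
  have key : ⁅a * c, b⁆ = a * ⁅c, b⁆ * a⁻¹ * ⁅a, b⁆ := by
    simp only [commutatorElement_def]; group
  rw [key]
  exact mul_mem (Subgroup.mem_sup_right (Subgroup.Normal.conj_mem inferInstance _ hcb a))
    (Subgroup.mem_sup_left (Subgroup.commutator_mem_commutator ha hb))

theorem iteratedCommutator_sup_le {G : Type*} [Group G] (A N B : Subgroup G) [N.Normal]
    (m : ℕ) :
    iteratedCommutator (A ⊔ N) B m ≤ iteratedCommutator A B m ⊔ N := by
  induction m with
  | zero => exact le_rfl
  | succ m ih =>
    exact (Subgroup.commutator_mono ih le_rfl).trans (commutator_sup_le_sup _ N B)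

/-- Let `G` be a group and `{1} = G_0 ≤ G_1 ≤ ⋯ ≤ G_n = G` a chain of
subgroups, each normal in `G`. Suppose that for each `0 ≤ i < n` there exists `m` with
`[G_{i+1}, G; m] ≤ G_i ⊔ ⁅G_{i+1}, G_{i+1}⁆` (i.e. `G/G_i` acts unipotently on
`H_1(G_{i+1}/G_i; ℤ)`). Then for each `0 ≤ i ≤ n` there exists `m` with
`[G_i, G; m] ≤ ⁅G_i, G_i⁆`, i.e. `G` acts unipotently on `H_1(G_i; ℤ)`. -/
theorem iterated_unipotent_of_chain {G : Type*} [Group G] (n : ℕ) (S : ℕ → Subgroup G)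
    (h0 : S 0 = ⊥) (hn : S n = ⊤)
    (hmono : ∀ i, i < n → S i ≤ S (i + 1))
    (hnorm : ∀ i, i ≤ n → (S i).Normal)
    (huni : ∀ i, i < n →
      ∃ m, iteratedCommutator (S (i + 1)) ⊤ m ≤ S i ⊔ ⁅S (i + 1), S (i + 1)⁆) :
    ∀ i, i ≤ n → ∃ m, iteratedCommutator (S i) ⊤ m ≤ ⁅S i, S i⁆ := by
  intro i
  induction i with
  | zero => exact fun _ => ⟨0, by simp [iteratedCommutator, h0]⟩
  | succ i ih =>
    intro hi
    obtain ⟨m, hm⟩ := ih (by lia)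
    obtain ⟨k, hk⟩ := huni i hi
    have := hnorm (i + 1) hi
    refine ⟨k + m, ?_⟩
    rw [iteratedCommutator_add]
    refine (iteratedCommutator_mono ⊤ hk m).trans ((iteratedCommutator_sup_le _ _ ⊤ m).trans ?_)
    exact sup_le (hm.trans (Subgroup.commutator_mono (hmono i hi) (hmono i hi))) le_rfl
end

section
/- Let G be a group and H a normal subgroup of G. If there exists m with [H, G; m] ≤ ⁅H, H⁆, then for every n there exists f such that [H, G; f] ≤ γ_{n+1}(H), where γ_{n+1}(H) = [H, H; n] is the (n+1)-st term of the lower central series of H (viewed as a subgroup of G). -/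
/-- The three subgroups lemma modulo a normal subgroup. -/
theorem commutator_commutator_le_of_rotate {G : Type*} [Group G] {A B C T : Subgroup G}
    [T.Normal] (h₁ : ⁅⁅B, C⁆, A⁆ ≤ T) (h₂ : ⁅⁅C, A⁆, B⁆ ≤ T) : ⁅⁅A, B⁆, C⁆ ≤ T := by
  have key : ∀ X : Subgroup G, X ≤ T ↔ X.map (QuotientGroup.mk' T) = ⊥ := fun X => by
    rw [Subgroup.map_eq_bot_iff, QuotientGroup.ker_mk']
  rw [key] at h₁ h₂ ⊢
  simp only [Subgroup.map_commutator] at h₁ h₂ ⊢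
  exact Subgroup.commutator_commutator_eq_bot_of_rotate h₁ h₂

theorem commutator_sup_top_le {G : Type*} [Group G] (A B : Subgroup G) [A.Normal] [B.Normal] :
    ⁅A ⊔ B, (⊤ : Subgroup G)⁆ ≤ ⁅A, ⊤⁆ ⊔ ⁅B, ⊤⁆ := by
  rw [Subgroup.commutator_le]
  intro z hz g hg
  obtain ⟨a, ha, b, hb, rfl⟩ := Subgroup.mem_sup_of_normal_right.mp hz
  rw [commutatorElement_mul_left_eq_conj_mul]
  refine mul_mem ?_ (Subgroup.mem_sup_left (Subgroup.commutator_mem_commutator ha hg))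
  exact Subgroup.mem_sup_right ((inferInstance : (⁅B, (⊤ : Subgroup G)⁆).Normal).conj_mem _
    (Subgroup.commutator_mem_commutator hb hg) a)

namespace iteratedCommutator

variable {G : Type*} [Group G]

instance normal (A B : Subgroup G) [A.Normal] [B.Normal] (n : ℕ) :
    (iteratedCommutator A B n).Normal := by
  induction n with
  | zero => assumption
  | succ n ih => exact Subgroup.commutator_normal _ _

theorem mono_left {A A' : Subgroup G} (h : A ≤ A') (B : Subgroup G) (n : ℕ) :
    iteratedCommutator A B n ≤ iteratedCommutator A' B n := by
  induction n with
  | zero => exact h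
  | succ n ih => exact Subgroup.commutator_mono ih le_rfl

theorem add (A B : Subgroup G) (m n : ℕ) :
    iteratedCommutator A B (m + n) = iteratedCommutator (iteratedCommutator A B m) B n := by
  induction n with
  | zero => rfl
  | succ n ih => exact congrArg (⁅·, B⁆) ih

theorem commutator_left (A B : Subgroup G) (n : ℕ) :
    iteratedCommutator ⁅A, B⁆ B n = iteratedCommutator A B (n + 1) := by
  rw [Nat.add_comm, add]
  rfl

theorem antitone (A B : Subgroup G) [A.Normal] [B.Normal] :
    Antitone (iteratedCommutator A B) :=
  antitone_nat_of_succ_le fun _ => Subgroup.commutator_le_left _ _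

theorem sup_le (A B : Subgroup G) [A.Normal] [B.Normal] (n : ℕ) :
    iteratedCommutator (A ⊔ B) ⊤ n ≤ iteratedCommutator A ⊤ n ⊔ iteratedCommutator B ⊤ n := by
  induction n with
  | zero => exact le_rfl
  | succ n ih => exact (Subgroup.commutator_mono ih le_rfl).trans (commutator_sup_top_le _ _)

/-- If `G` acts unipotently on `A` and on `B`, modulo the subgroups whose commutators with the
other factor lie in `T`, then it acts unipotently on `⁅A, B⁆` modulo `T`. -/
theorem exists_commutator_le {T : Subgroup G} (a b : ℕ) (A B : Subgroup G)
    [A.Normal] [B.Normal]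
    (ha : ⁅iteratedCommutator A ⊤ a, B⁆ ≤ T) (hb : ⁅A, iteratedCommutator B ⊤ b⁆ ≤ T) :
    ∃ f, iteratedCommutator ⁅A, B⁆ ⊤ f ≤ T := by
  induction a generalizing b A B with
  | zero => exact ⟨0, ha⟩
  | succ a iha =>
    induction b generalizing A B with
    | zero => exact ⟨0, hb⟩
    | succ b ihb =>
      obtain ⟨f, hf⟩ := iha (b + 1) ⁅A, ⊤⁆ B (by rwa [commutator_left])
        ((Subgroup.commutator_mono (Subgroup.commutator_le_left _ _) le_rfl).trans hb)
      obtain ⟨g, hg⟩ := ihb A ⁅B, ⊤⁆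
        ((Subgroup.commutator_mono le_rfl (Subgroup.commutator_le_left _ _)).trans ha)
        (by rwa [commutator_left])
      have key : ⁅⁅A, B⁆, (⊤ : Subgroup G)⁆ ≤
          ⁅⁅A, (⊤ : Subgroup G)⁆, B⁆ ⊔ ⁅A, ⁅B, (⊤ : Subgroup G)⁆⁆ := by
        apply commutator_commutator_le_of_rotate
        · rw [Subgroup.commutator_comm _ A]
          exact le_sup_right
        · rw [Subgroup.commutator_comm ⊤ A]
          exact le_sup_left
      refine ⟨max f g + 1, ?_⟩
      rw [← commutator_left]
      exact ((mono_left key _ _).trans (sup_le _ _ _)).trans (_root_.sup_le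
        ((antitone _ _ (le_max_left f g)).trans hf) ((antitone _ _ (le_max_right f g)).trans hg))

/-- If `G` acts unipotently on the abelianization of `H`, then it acts unipotently on every
quotient of consecutive terms of the lower central series of `H`. -/
theorem exists_lowerCentral_le_succ (H : Subgroup G) [H.Normal] (m : ℕ)
    (hm : iteratedCommutator H ⊤ m ≤ ⁅H, H⁆) (n : ℕ) :
    ∃ f, iteratedCommutator (iteratedCommutator H H n) ⊤ f ≤ iteratedCommutator H H (n + 1) := by
  induction n with
  | zero => exact ⟨m, hm⟩
  | succ n ih =>
    obtain ⟨f, hf⟩ := ih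
    refine exists_commutator_le f m _ H (Subgroup.commutator_mono hf le_rfl)
      ((Subgroup.commutator_mono le_rfl hm).trans ?_)
    rw [Subgroup.commutator_comm]
    apply commutator_commutator_le_of_rotate
    · rw [Subgroup.commutator_comm H]
      exact le_rfl
    · exact le_rfl

end iteratedCommutator

/-- Let `G` be a group and `H` a normal subgroup of `G`. If there exists
`m` with `[H, G; m] ≤ ⁅H, H⁆`, then for every `n` there exists `f` such that
`[H, G; f] ≤ γ_{n+1}(H)`, where `γ_{n+1}(H) = [H, H; n]` is the `(n+1)`-st term of the
lower central series of `H` (viewed as a subgroup of `G`). -/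
theorem iteratedCommutator_le_lowerCentral_of_unipotent {G : Type*} [Group G]
    (H : Subgroup G) [H.Normal] (m : ℕ)
    (hm : iteratedCommutator H ⊤ m ≤ ⁅H, H⁆) :
    ∀ n : ℕ, ∃ f : ℕ, iteratedCommutator H ⊤ f ≤ iteratedCommutator H H n := by
  intro n
  induction n with
  | zero => exact ⟨0, le_rfl⟩
  | succ n ih =>
    obtain ⟨f, hf⟩ := ih
    obtain ⟨g, hg⟩ := iteratedCommutator.exists_lowerCentral_le_succ H m hm n
    refine ⟨f + g, ?_⟩
    rw [iteratedCommutator.add]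
    exact (iteratedCommutator.mono_left hf _ _).trans hg
end
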